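/- Let p ∈ (1,∞). Then lim_{a→0⁺} θ_a = 0 and lim_{a→∞} θ_a = ∫₀¹ du / (u·√(K(u))) = (π/2)·(1 − (1/2)·√(2(p−1)/p)); consequently the range of the map a ↦ θ_a on (0,∞) is exactly the open interval (0, (π/2)·(1 − (1/2)·√(2(p−1)/p))). -/

import Mathlib

open Set Real Filter MeasureTheory

/-- `F_a(y,w)` from the paper (with parameter `p`). -/
noncomputable def Fa (p a y w : ℝ) : ℝ :=
  (8*p*(1/a + 2*y) + (2*p/a + 4*(3*p - 2)*y + 2*(p - 1)*y*w)*w) / (y^2 * (4 + (p - 1)*w))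

/-- `G` is the family `a ↦ G_a` of solutions of `G_a' = -F_a(y, G_a)` on `(0,1)`
with `G_a(1) = 0`: each `G_a` is continuous on `(0,1]`, positive on `(0,1)` and
strictly decreasing on `(0,1]`. -/
def IsGFamily (p : ℝ) (G : ℝ → ℝ → ℝ) : Prop :=
  ∀ a : ℝ, 0 < a →
    ContinuousOn (G a) (Set.Ioc 0 1) ∧
    G a 1 = 0 ∧
    (∀ y ∈ Set.Ioo (0:ℝ) 1, HasDerivAt (G a) (-(Fa p a y (G a y))) y) ∧
    (∀ y ∈ Set.Ioo (0:ℝ) 1, 0 < G a y) ∧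
    StrictAntiOn (G a) (Set.Ioc 0 1)

/-- `H_a(y) = y² G_a(y/a)`. -/
noncomputable def Ha (G : ℝ → ℝ → ℝ) (a y : ℝ) : ℝ := y^2 * G a (y/a)

/-- `g(t) = ∫_t^a H_a(w)^{-1/2} dw`. -/
noncomputable def gfun (G : ℝ → ℝ → ℝ) (a t : ℝ) : ℝ :=
  ∫ w in Set.Ioo t a, (Real.sqrt (Ha G a w))⁻¹

/-- `θ_a = ∫_0^a H_a(w)^{-1/2} dw`. -/
noncomputable def thetaA (G : ℝ → ℝ → ℝ) (a : ℝ) : ℝ := gfun G a 0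

theorem Fa_eq {p a y w : ℝ} (hp : 1 < p) (ha : 0 < a) (hy : 0 < y) (hw : 0 ≤ w) :
    Fa p a y w =
      (w + 4) / (y ^ 2 * (4 + (p - 1) * w)) * (2 * p / a + 2 * y * ((p - 1) * w + 2 * p)) := by
  have h : 0 < 4 + (p - 1) * w := by nlinarith
  unfold Fa
  field_simp
  ring

theorem add_four_le_mul_Fa {p a y w : ℝ} (hp : 1 < p) (ha : 0 < a) (hy : 0 < y) (hw : 0 ≤ w) :
    w + 4 ≤ y * Fa p a y w := by
  have hcw : 0 ≤ (p - 1) * w := mul_nonneg (by linarith) hw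
  have h : 0 < 4 + (p - 1) * w := by linarith
  have hpa : 0 ≤ 2 * p / a := by positivity
  rw [Fa_eq hp ha hy hw]
  have e : y * ((w + 4) / (y ^ 2 * (4 + (p - 1) * w)) *
      (2 * p / a + 2 * y * ((p - 1) * w + 2 * p)))
      = (w + 4) * ((2 * p / a + 2 * y * ((p - 1) * w + 2 * p)) / (y * (4 + (p - 1) * w))) := by
    field_simp
  rw [e]
  refine le_mul_of_one_le_right (by linarith) ?_
  rw [one_le_div (by positivity)]
  nlinarith

theorem div_le_Fa {p a y w : ℝ} (hp : 1 < p) (ha : 0 < a) (hy : 0 < y) (hy1 : y ≤ 1)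
    (hw : 0 ≤ w) : 2 / a ≤ Fa p a y w := by
  have hcw : 0 ≤ (p - 1) * w := mul_nonneg (by linarith) hw
  have h : 0 < 4 + (p - 1) * w := by linarith
  rw [Fa_eq hp ha hy hw, div_mul_eq_mul_div, le_div_iff₀ (by positivity)]
  have h1 : y ^ 2 * (4 + (p - 1) * w) ≤ 4 + (p - 1) * w :=
    mul_le_of_le_one_left h.le (by nlinarith)
  calc 2 / a * (y ^ 2 * (4 + (p - 1) * w)) ≤ 2 / a * (4 + (p - 1) * w) := by gcongr
    _ ≤ 2 / a * (p * (w + 4)) := by gcongr; nlinarith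
    _ = (w + 4) * (2 * p / a) := by ring
    _ ≤ _ := by
      gcongr
      have : 0 ≤ 2 * y * ((p - 1) * w + 2 * p) := by positivity
      linarith

theorem abs_Fa_sub_Fa_le {p a b x y w v : ℝ} (hp : 1 < p) (ha : 0 < a) (hb : 0 < b)
    (hy : 0 < y) (hyx : y ≤ x) (hw : 0 ≤ w) (hv : 0 ≤ v) :
    |Fa p a x w - Fa p b x v| ≤
      (2 / y + p * (4 * (p + 2) / y + 2 * p / (a * y ^ 2)) + 2 * p * (1 + 1 / (p - 1)) / y ^ 2) *
        (|w - v| + |1 / a - 1 / b|) := by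
  obtain ⟨c, rfl⟩ : ∃ c, p = c + 1 := ⟨p - 1, by ring⟩
  have hc : 0 < c := by linarith
  have hx : 0 < x := hy.trans_le hyx
  have hw4 : 0 < 4 + c * w := by positivity
  have hv4 : 0 < 4 + c * v := by positivity
  have key : Fa (c + 1) a x w - Fa (c + 1) b x v =
      2 / x * (w - v) + ((4 + w) / (4 + c * w) - (4 + v) / (4 + c * v)) *
        (4 * (c - 1) / x + 2 * (c + 1) / (a * x ^ 2))
        + 2 * (c + 1) * ((4 + v) / (4 + c * v)) / x ^ 2 * (1 / a - 1 / b) := by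
    rw [Fa_eq hp ha hx hw, Fa_eq hp hb hx hv]
    simp only [add_sub_cancel_right]
    field_simp
    ring
  have hh : |(4 + w) / (4 + c * w) - (4 + v) / (4 + c * v)| ≤ (c + 1) * |w - v| := by
    rw [div_sub_div _ _ hw4.ne' hv4.ne', abs_div, abs_of_pos (mul_pos hw4 hv4),
      div_le_iff₀ (mul_pos hw4 hv4)]
    have e : (4 + w) * (4 + c * v) - (4 + c * w) * (4 + v) = (4 * (1 - c)) * (w - v) := by ring
    rw [e, abs_mul]
    have h1 : |4 * (1 - c)| ≤ 4 * (c + 1) := by rw [abs_le]; constructor <;> linarith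
    have h2 : 4 ≤ (4 + c * w) * (4 + c * v) := by
      have := mul_nonneg hc.le hw
      have := mul_nonneg hc.le hv
      nlinarith
    calc |4 * (1 - c)| * |w - v| ≤ 4 * (c + 1) * |w - v| := by gcongr
      _ = (c + 1) * |w - v| * 4 := by ring
      _ ≤ _ := by gcongr
  have hh2 : (4 + v) / (4 + c * v) ≤ 1 + 1 / c := by
    rw [div_le_iff₀ hv4]
    have e : (1 + 1 / c) * (4 + c * v) = 4 + v + (4 / c + c * v) := by field_simp; ring
    rw [e]
    have : 0 ≤ 4 / c + c * v := by positivity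
    linarith
  have hk : |4 * (c - 1) / x + 2 * (c + 1) / (a * x ^ 2)| ≤
      4 * (c + 1 + 2) / y + 2 * (c + 1) / (a * y ^ 2) := by
    refine (abs_add_le _ _).trans (add_le_add ?_ ?_)
    · rw [abs_div, abs_of_pos hx]
      gcongr
      rw [abs_le]; constructor <;> linarith
    · rw [abs_of_nonneg (by positivity)]
      gcongr
  rw [key]
  simp only [add_sub_cancel_right]
  set D := |w - v|
  set d := |1 / a - 1 / b|
  have hD : 0 ≤ D := abs_nonneg _
  have hd : 0 ≤ d := abs_nonneg _
  set B := 4 * (c + 1 + 2) / y + 2 * (c + 1) / (a * y ^ 2)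
  have hB : 0 ≤ B := by positivity
  calc _ ≤ 2 / y * D + ((c + 1) * D) * B + 2 * (c + 1) * (1 + 1 / c) / y ^ 2 * d := by
        refine (abs_add_three _ _ _).trans (add_le_add (add_le_add ?_ ?_) ?_)
        · rw [abs_mul, abs_of_pos (by positivity)]
          gcongr
        · rw [abs_mul]
          gcongr
        · rw [abs_mul, abs_of_nonneg (by positivity)]
          gcongr
    _ ≤ _ := by
        have h1 : 0 ≤ 2 / y * d := by positivity
        have h2 : 0 ≤ (c + 1) * B * d := by positivity
        have h3 : 0 ≤ 2 * (c + 1) * (1 + 1 / c) / y ^ 2 * D := by positivity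
        nlinarith

namespace IsGFamily

variable {p : ℝ} {G : ℝ → ℝ → ℝ} {a y : ℝ}

theorem nonneg (hG : IsGFamily p G) (ha : 0 < a) (hy : y ∈ Ioc (0 : ℝ) 1) : 0 ≤ G a y := by
  obtain ⟨-, h1, -, hpos, -⟩ := hG a ha
  rcases hy.2.eq_or_lt with h | h
  · rw [h, h1]
  · exact (hpos y ⟨hy.1, h⟩).le

theorem four_le (hp : 1 < p) (hG : IsGFamily p G) (ha : 0 < a) (hy : y ∈ Ioc (0 : ℝ) 1) :
    4 ≤ (G a y + 4) * y := by
  obtain ⟨hc, h1, hd, hpos, -⟩ := hG a ha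
  have hsub : Icc y 1 ⊆ Ioc (0 : ℝ) 1 := fun x hx => ⟨hy.1.trans_le hx.1, hx.2⟩
  have hder : ∀ x ∈ interior (Icc y 1), HasDerivAt (fun x => (G a x + 4) * x)
      (-(Fa p a x (G a x)) * x + (G a x + 4) * 1) x := by
    intro x hx
    rw [interior_Icc] at hx
    exact ((hd x ⟨hy.1.trans hx.1, hx.2⟩).add_const 4).mul (hasDerivAt_id x)
  have hanti : AntitoneOn (fun x => (G a x + 4) * x) (Icc y 1) := by
    refine antitoneOn_of_deriv_nonpos (convex_Icc y 1) ?_ ?_ ?_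
    · exact ((hc.mono hsub).add continuousOn_const).mul continuousOn_id
    · exact fun x hx => (hder x hx).differentiableAt.differentiableWithinAt
    · intro x hx
      rw [(hder x hx).deriv]
      rw [interior_Icc] at hx
      have hx0 : 0 < x := hy.1.trans hx.1
      have := add_four_le_mul_Fa hp ha hx0 (hpos x ⟨hx0, hx.2⟩).le
      linarith
  have := hanti (left_mem_Icc.2 hy.2) (right_mem_Icc.2 hy.2) hy.2
  simp only [h1] at this
  linarith

theorem div_le (hp : 1 < p) (hG : IsGFamily p G) (ha : 0 < a) (hy : y ∈ Ioc (0 : ℝ) 1) :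
    2 * (1 - y) / a ≤ G a y := by
  obtain ⟨hc, h1, hd, hpos, -⟩ := hG a ha
  have hsub : Icc y 1 ⊆ Ioc (0 : ℝ) 1 := fun x hx => ⟨hy.1.trans_le hx.1, hx.2⟩
  have hder : ∀ x ∈ interior (Icc y 1), HasDerivAt (fun x => G a x + 2 / a * x)
      (-(Fa p a x (G a x)) + 2 / a * 1) x := by
    intro x hx
    rw [interior_Icc] at hx
    exact (hd x ⟨hy.1.trans hx.1, hx.2⟩).add ((hasDerivAt_id x).const_mul (2 / a))
  have hanti : AntitoneOn (fun x => G a x + 2 / a * x) (Icc y 1) := by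
    refine antitoneOn_of_deriv_nonpos (convex_Icc y 1) ?_ ?_ ?_
    · exact (hc.mono hsub).add (continuousOn_const.mul continuousOn_id)
    · exact fun x hx => (hder x hx).differentiableAt.differentiableWithinAt
    · intro x hx
      rw [(hder x hx).deriv]
      rw [interior_Icc] at hx
      have hx0 : 0 < x := hy.1.trans hx.1
      have := div_le_Fa hp ha hx0 hx.2.le (hpos x ⟨hx0, hx.2⟩).le
      linarith
  have := hanti (left_mem_Icc.2 hy.2) (right_mem_Icc.2 hy.2) hy.2
  simp only [h1] at this
  have e : 2 * (1 - y) / a = 2 / a * 1 - 2 / a * y := by ring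
  linarith

theorem tendsto_zero (hp : 1 < p) (hG : IsGFamily p G) (ha : 0 < a) :
    Tendsto (G a) (nhdsWithin 0 (Ioi 0)) atTop := by
  have h : Tendsto (fun y : ℝ => 4 * y⁻¹ + (-4)) (nhdsWithin 0 (Ioi 0)) atTop :=
    tendsto_atTop_add_const_right _ _ (tendsto_inv_nhdsGT_zero.const_mul_atTop (by norm_num))
  refine tendsto_atTop_mono' _ ?_ h
  filter_upwards [Ioo_mem_nhdsGT (zero_lt_one (α := ℝ))] with y hy
  have := hG.four_le hp ha ⟨hy.1, hy.2.le⟩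
  have h2 : 4 * y⁻¹ ≤ G a y + 4 := by
    rw [← div_eq_mul_inv, div_le_iff₀ hy.1]; exact this
  linarith

theorem tendsto_one (hG : IsGFamily p G) (ha : 0 < a) :
    Tendsto (G a) (nhdsWithin 1 (Iio 1)) (nhds 0) := by
  obtain ⟨hc, h1, -⟩ := hG a ha
  have := hc 1 ⟨zero_lt_one, le_rfl⟩
  rw [ContinuousWithinAt, h1] at this
  refine this.mono_left ?_
  rw [← nhdsWithin_Ioo_eq_nhdsLT (zero_lt_one (α := ℝ))]
  exact nhdsWithin_mono _ Ioo_subset_Ioc_self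

theorem continuousOn_Ioo (hG : IsGFamily p G) (ha : 0 < a) : ContinuousOn (G a) (Ioo 0 1) :=
  (hG a ha).1.mono Ioo_subset_Ioc_self

/-- Continuous dependence of the solution on the parameter `a`. -/
theorem tendsto_param (hp : 1 < p) (hG : IsGFamily p G) (ha : 0 < a) (hy : y ∈ Ioo (0 : ℝ) 1) :
    Tendsto (fun b => G b y) (nhds a) (nhds (G a y)) := by
  obtain ⟨hca, h1a, hda, -, -⟩ := hG a ha
  set A : ℝ := 2 / y + p * (4 * (p + 2) / y + 2 * p / (a * y ^ 2)) +
    2 * p * (1 + 1 / (p - 1)) / y ^ 2 with hA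
  have hA0 : 0 ≤ A := by
    have := hy.1
    have : 0 < p - 1 := by linarith
    positivity
  have hbound : ∀ b, 0 < b → |G b y - G a y| ≤ |(1 / a - 1 / b) * exp (3 * A / 2)| := by
    intro b hb
    obtain ⟨hcb, h1b, hdb, -, -⟩ := hG b hb
    set d := 1 / a - 1 / b with hd
    have hsub : Icc y 1 ⊆ Ioc (0 : ℝ) 1 := fun x hx => ⟨hy.1.trans_le hx.1, hx.2⟩
    have hder : ∀ x ∈ interior (Icc y 1),
        HasDerivAt (fun x => ((G a x - G b x) ^ 2 + d ^ 2) * exp (3 * A * x))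
          ((2 * (G a x - G b x) * (-(Fa p a x (G a x)) - -(Fa p b x (G b x)))) * exp (3 * A * x) +
            ((G a x - G b x) ^ 2 + d ^ 2) * (exp (3 * A * x) * (3 * A))) x := by
      intro x hx
      rw [interior_Icc] at hx
      have hx' : x ∈ Ioo (0 : ℝ) 1 := ⟨hy.1.trans hx.1, hx.2⟩
      have h1 := (((hda x hx').sub (hdb x hx')).pow 2).add_const (d ^ 2)
      have h2 := ((hasDerivAt_id x).const_mul (3 * A)).exp
      refine (h1.mul h2).congr_deriv ?_
      simp
    have hmono : MonotoneOn (fun x => ((G a x - G b x) ^ 2 + d ^ 2) * exp (3 * A * x))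
        (Icc y 1) := by
      refine monotoneOn_of_deriv_nonneg (convex_Icc y 1) ?_ ?_ ?_
      · exact ((((hca.mono hsub).sub (hcb.mono hsub)).pow 2).add continuousOn_const).mul
          (by fun_prop)
      · exact fun x hx => (hder x hx).differentiableAt.differentiableWithinAt
      · intro x hx
        rw [(hder x hx).deriv]
        rw [interior_Icc] at hx
        have hx0 : 0 < x := hy.1.trans hx.1
        have hF := abs_Fa_sub_Fa_le hp ha hb hy.1 hx.1.le (hG.nonneg ha ⟨hx0, hx.2.le⟩)
          (hG.nonneg hb ⟨hx0, hx.2.le⟩)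
        rw [← hA, ← hd] at hF
        set D := G a x - G b x
        set E := Fa p a x (G a x) - Fa p b x (G b x) with hE
        have h1 : D * E ≤ |D| * (A * (|D| + |d|)) :=
          (le_abs_self _).trans (by rw [abs_mul]; gcongr)
        have h2 : 2 * (|D| * (A * (|D| + |d|))) ≤ 3 * A * (D ^ 2 + d ^ 2) := by
          rw [← sq_abs D, ← sq_abs d]
          nlinarith [mul_nonneg hA0 (sq_nonneg (|D| - |d|)), mul_nonneg hA0 (sq_nonneg |d|)]
        have h3 : 0 ≤ exp (3 * A * x) * (3 * A * (D ^ 2 + d ^ 2) - 2 * (D * E)) :=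
          mul_nonneg (exp_pos _).le (by linarith)
        have e : 2 * D * (-(Fa p a x (G a x)) - -(Fa p b x (G b x))) = -(2 * (D * E)) := by
          rw [hE]; ring
        rw [e]
        linarith
    have h := hmono (left_mem_Icc.2 hy.2.le) (right_mem_Icc.2 hy.2.le) hy.2.le
    simp only [h1a, h1b] at h
    have h1 : 1 ≤ exp (3 * A * y) := one_le_exp (by have := hy.1; positivity)
    rw [← sq_le_sq, mul_pow, ← exp_nat_mul]
    have e : ((2 : ℕ) : ℝ) * (3 * A / 2) = 3 * A := by push_cast; ring
    rw [e]
    have h2 := le_mul_of_one_le_right (by positivity : 0 ≤ (G a y - G b y) ^ 2 + d ^ 2) h1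
    rw [mul_one] at h
    linarith [sq_nonneg d]
  rw [tendsto_iff_norm_sub_tendsto_zero]
  have hlim : Tendsto (fun b => |(1 / a - 1 / b) * exp (3 * A / 2)|) (nhds a) (nhds 0) := by
    have : ContinuousAt (fun b => |(1 / a - 1 / b) * exp (3 * A / 2)|) a := by
      have := ha.ne'
      fun_prop (disch := assumption)
    simpa [ContinuousAt] using this
  refine squeeze_zero' (Eventually.of_forall fun b => norm_nonneg _) ?_ hlim
  filter_upwards [lt_mem_nhds ha] with b hb using hbound b hb

end IsGFamily

theorem intervalIntegrable_inv_sqrt_mul_one_sub :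
    IntervalIntegrable (fun u : ℝ => (√(u * (1 - u)))⁻¹) volume 0 1 := by
  rw [intervalIntegrable_iff_integrableOn_Ioc_of_le zero_le_one]
  refine intervalIntegral.integrableOn_deriv_of_nonneg (g := fun u => arcsin (2 * u - 1))
    (by fun_prop) ?_ fun u _ => by positivity
  intro u hu
  have hu0 : 0 < u * (1 - u) := mul_pos hu.1 (by linarith [hu.2])
  have h := (hasDerivAt_arcsin (x := 2 * u - 1) (by linarith [hu.1]) (by linarith [hu.2])).comp u
    (((hasDerivAt_id u).const_mul 2).sub_const 1)
  refine h.congr_deriv ?_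
  have e : 1 - (2 * u - 1) ^ 2 = 2 ^ 2 * (u * (1 - u)) := by ring
  rw [e, sqrt_mul (sq_nonneg (2 : ℝ)), sqrt_sq (zero_le_two (α := ℝ))]
  field_simp

theorem inv_mul_sqrt_le {u w : ℝ} (hu : u ∈ Ioo (0 : ℝ) 1) (h : 4 ≤ (w + 4) * u) :
    (u * √w)⁻¹ ≤ (√(u * (1 - u)))⁻¹ := by
  have hu0 : 0 < u * (1 - u) := mul_pos hu.1 (by linarith [hu.2])
  refine inv_anti₀ (sqrt_pos.2 hu0) ?_
  rw [← sqrt_sq hu.1.le, ← sqrt_mul (sq_nonneg u), sqrt_sq hu.1.le]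
  apply sqrt_le_sqrt
  nlinarith [hu.1, hu.2]

/-- The limiting angle. -/
noncomputable def limitAngle (p : ℝ) : ℝ := π / 2 * (1 - 1 / 2 * √(2 * (p - 1) / p))

/-- An antiderivative, in terms of `w = K(u)`, of the angle integrand of the limiting equation. -/
noncomputable def anglePrimitive (p w : ℝ) : ℝ :=
  arctan (√w / 2) - √((p - 1) / (2 * p)) * arctan (√((p - 1) / (2 * p)) * √w)

theorem continuous_anglePrimitive (p : ℝ) : Continuous (anglePrimitive p) := by
  unfold anglePrimitive
  fun_prop

theorem anglePrimitive_zero (p : ℝ) : anglePrimitive p 0 = 0 := by simp [anglePrimitive]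

theorem hasDerivAt_anglePrimitive {p w : ℝ} (hp : 1 < p) (hw : 0 < w) :
    HasDerivAt (anglePrimitive p)
      ((4 + (p - 1) * w) / (2 * √w * (w + 4) * ((p - 1) * w + 2 * p))) w := by
  obtain ⟨c, rfl⟩ : ∃ c, p = c + 1 := ⟨p - 1, by ring⟩
  have hc : 0 < c := by linarith
  have hs := hasDerivAt_sqrt hw.ne'
  have h := (hs.div_const 2).arctan.sub
    ((hs.const_mul √((c + 1 - 1) / (2 * (c + 1)))).arctan.const_mul
      √((c + 1 - 1) / (2 * (c + 1))))
  refine h.congr_deriv ?_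
  have hr : √((c + 1 - 1) / (2 * (c + 1))) ^ 2 = c / (2 * (c + 1)) := by
    rw [sq_sqrt (by simp only [add_sub_cancel_right]; positivity), add_sub_cancel_right]
  have hw2 : √w ^ 2 = w := sq_sqrt hw.le
  set r := √((c + 1 - 1) / (2 * (c + 1)))
  have hsw : 0 < √w := sqrt_pos.2 hw
  have e : 1 / (1 + (√w / 2) ^ 2) * (1 / (2 * √w) / 2) -
      r * (1 / (1 + (r * √w) ^ 2) * (r * (1 / (2 * √w)))) =
      1 / (1 + √w ^ 2 / 4) * (1 / (2 * √w) / 2) -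
      r ^ 2 * (1 / (1 + r ^ 2 * √w ^ 2) * (1 / (2 * √w))) := by ring
  rw [e, hr, hw2, add_sub_cancel_right]
  have : 1 + c / (2 * (c + 1)) * w ≠ 0 := by positivity
  field_simp
  ring

theorem tendsto_anglePrimitive_atTop {p : ℝ} (hp : 1 < p) :
    Tendsto (anglePrimitive p) atTop (nhds (limitAngle p)) := by
  have hp1 : 0 < p - 1 := by linarith
  have hr : 0 < √((p - 1) / (2 * p)) := sqrt_pos.2 (by positivity)
  have harc : Tendsto arctan atTop (nhds (π / 2)) :=
    tendsto_arctan_atTop.mono_right nhdsWithin_le_nhds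
  have h1 := harc.comp (tendsto_sqrt_atTop.atTop_div_const (zero_lt_two (α := ℝ)))
  have h2 := (harc.comp (tendsto_sqrt_atTop.const_mul_atTop hr)).const_mul √((p - 1) / (2 * p))
  have e : limitAngle p = π / 2 - √((p - 1) / (2 * p)) * (π / 2) := by
    have : 2 * (p - 1) / p = 2 ^ 2 * ((p - 1) / (2 * p)) := by field_simp
    rw [limitAngle, this, sqrt_mul (by norm_num), sqrt_sq (by norm_num)]
    ring
  rw [e]
  exact h1.sub h2

theorem thetaA_eq (G : ℝ → ℝ → ℝ) {a : ℝ} (ha : 0 < a) :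
    thetaA G a = ∫ u in (0 : ℝ)..1, (u * √(G a u))⁻¹ := by
  have h := intervalIntegral.integral_comp_div (a := 0) (b := a)
    (fun u => (u * √(G a u))⁻¹) ha.ne'
  rw [zero_div, div_self ha.ne', smul_eq_mul] at h
  rw [thetaA, gfun, ← integral_Ioc_eq_integral_Ioo, ← intervalIntegral.integral_of_le ha.le,
    ← mul_right_inj' ha.ne', ← h, ← intervalIntegral.integral_const_mul]
  refine intervalIntegral.integral_congr fun w hw => ?_
  rw [uIcc_of_le ha.le] at hw
  simp only [Ha]
  rw [sqrt_mul (sq_nonneg w), sqrt_sq hw.1, mul_inv, mul_inv, inv_div]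
  ring

namespace IsGFamily

variable {p : ℝ} {G : ℝ → ℝ → ℝ} {a : ℝ}

theorem aestronglyMeasurable (hG : IsGFamily p G) (ha : 0 < a) :
    AEStronglyMeasurable (fun u => (u * √(G a u))⁻¹) (volume.restrict (uIoc 0 1)) := by
  rw [uIoc_of_le zero_le_one, ← Measure.restrict_congr_set Ioo_ae_eq_Ioc]
  refine ContinuousOn.aestronglyMeasurable ?_ measurableSet_Ioo
  refine (continuousOn_id.mul (hG.continuousOn_Ioo ha).sqrt).inv₀ fun u hu => ?_
  have := (hG a ha).2.2.2.1 u hu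
  exact mul_ne_zero hu.1.ne' (sqrt_pos.2 this).ne'

theorem ae_norm_le (hp : 1 < p) (hG : IsGFamily p G) (ha : 0 < a) :
    ∀ᵐ u, u ∈ uIoc (0 : ℝ) 1 → ‖(u * √(G a u))⁻¹‖ ≤ (√(u * (1 - u)))⁻¹ := by
  filter_upwards [Measure.ae_ne volume (1 : ℝ)] with u hu1 hu
  rw [uIoc_of_le zero_le_one] at hu
  rw [norm_of_nonneg (inv_nonneg.2 (mul_nonneg hu.1.le (sqrt_nonneg _)))]
  exact inv_mul_sqrt_le ⟨hu.1, hu.2.lt_of_ne hu1⟩ (hG.four_le hp ha hu)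

theorem intervalIntegrable (hp : 1 < p) (hG : IsGFamily p G) (ha : 0 < a) :
    IntervalIntegrable (fun u => (u * √(G a u))⁻¹) volume 0 1 :=
  intervalIntegrable_inv_sqrt_mul_one_sub.mono_fun (hG.aestronglyMeasurable ha) <| by
    rw [Filter.EventuallyLE, ae_restrict_iff' measurableSet_uIoc]
    filter_upwards [hG.ae_norm_le hp ha] with u hu hu'
    exact (hu hu').trans (le_abs_self _)

/-- Dominated convergence for the angle integrals along a filter of parameters. -/
theorem tendsto_integral (hp : 1 < p) (hG : IsGFamily p G) {l : Filter ℝ}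
    [l.IsCountablyGenerated] (hl : ∀ᶠ a in l, 0 < a) {f : ℝ → ℝ}
    (hf : ∀ u ∈ Ioo (0 : ℝ) 1, Tendsto (fun a => (u * √(G a u))⁻¹) l (nhds (f u))) :
    Tendsto (thetaA G) l (nhds (∫ u in (0 : ℝ)..1, f u)) := by
  have h : Tendsto (fun a => ∫ u in (0 : ℝ)..1, (u * √(G a u))⁻¹) l
      (nhds (∫ u in (0 : ℝ)..1, f u)) := by
    refine intervalIntegral.tendsto_integral_filter_of_dominated_convergence
      (fun u : ℝ => (√(u * (1 - u)))⁻¹) ?_ ?_ intervalIntegrable_inv_sqrt_mul_one_sub ?_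
    · filter_upwards [hl] with a ha using hG.aestronglyMeasurable ha
    · filter_upwards [hl] with a ha using hG.ae_norm_le hp ha
    · filter_upwards [Measure.ae_ne volume (1 : ℝ)] with u hu1 hu
      rw [uIoc_of_le zero_le_one] at hu
      exact hf u ⟨hu.1, hu.2.lt_of_ne hu1⟩
  refine h.congr' ?_
  filter_upwards [hl] with a ha using (thetaA_eq G ha).symm

theorem continuousOn_thetaA (hp : 1 < p) (hG : IsGFamily p G) :
    ContinuousOn (thetaA G) (Ioi 0) := by
  intro a ha
  refine ContinuousAt.continuousWithinAt ?_
  have ha : 0 < a := ha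
  rw [ContinuousAt, thetaA_eq G ha]
  refine hG.tendsto_integral hp (lt_mem_nhds ha) fun u hu => ?_
  have hpos := (hG a ha).2.2.2.1 u hu
  exact ((hG.tendsto_param hp ha hu).sqrt.const_mul u).inv₀
    (mul_ne_zero hu.1.ne' (sqrt_pos.2 hpos).ne')

theorem tendsto_thetaA_zero (hp : 1 < p) (hG : IsGFamily p G) :
    Tendsto (thetaA G) (nhdsWithin 0 (Ioi 0)) (nhds 0) := by
  have h := hG.tendsto_integral hp (l := nhdsWithin 0 (Ioi 0)) (f := fun _ => 0)
    self_mem_nhdsWithin fun u hu => ?_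
  · simpa using h
  refine tendsto_inv_atTop_zero.comp ((tendsto_sqrt_atTop.comp ?_).const_mul_atTop hu.1)
  have h1 : Tendsto (fun a : ℝ => 2 * (1 - u) * a⁻¹) (nhdsWithin 0 (Ioi 0)) atTop :=
    tendsto_inv_nhdsGT_zero.const_mul_atTop (by linarith [hu.2])
  refine tendsto_atTop_mono' _ ?_ h1
  filter_upwards [self_mem_nhdsWithin] with a ha
  exact hG.div_le hp ha ⟨hu.1, hu.2.le⟩

theorem tendsto_thetaA_atTop (hp : 1 < p) (hG : IsGFamily p G) {K : ℝ → ℝ}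
    (hK : ∀ y ∈ Ioc (0 : ℝ) 1, Tendsto (fun a => G a y) atTop (nhds (K y))) :
    Tendsto (thetaA G) atTop (nhds (∫ u in (0 : ℝ)..1, (u * √(K u))⁻¹)) := by
  refine hG.tendsto_integral hp (eventually_gt_atTop 0) fun u hu => ?_
  have hK' := hK u ⟨hu.1, hu.2.le⟩
  have hKpos : 0 < K u := by
    have h4 : 4 ≤ (K u + 4) * u := by
      refine ge_of_tendsto ((hK'.add_const 4).mul_const u) ?_
      filter_upwards [eventually_gt_atTop 0] with a ha
      exact hG.four_le hp ha ⟨hu.1, hu.2.le⟩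
    by_contra! hneg
    nlinarith [hu.1, hu.2]
  exact (hK'.sqrt.const_mul u).inv₀ (mul_ne_zero hu.1.ne' (sqrt_pos.2 hKpos).ne')

theorem thetaA_pos (hp : 1 < p) (hG : IsGFamily p G) (ha : 0 < a) : 0 < thetaA G a := by
  rw [thetaA_eq G ha]
  refine intervalIntegral.intervalIntegral_pos_of_pos_on (hG.intervalIntegrable hp ha) ?_
    zero_lt_one
  intro u hu
  exact inv_pos.2 (mul_pos hu.1 (sqrt_pos.2 ((hG a ha).2.2.2.1 u hu)))

end IsGFamily

/-- The difference between the angle integrands of the limiting equation and of the equation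
with parameter `a`. -/
noncomputable def angleDefect (p a u w : ℝ) : ℝ :=
  p / (a * (u * ((p - 1) * w + 2 * p))) * (u * √w)⁻¹

theorem angleDefect_pos {p a u w : ℝ} (hp : 1 < p) (ha : 0 < a) (hu : 0 < u) (hw : 0 < w) :
    0 < angleDefect p a u w := by
  have : 0 < (p - 1) * w := mul_pos (by linarith) hw
  have := sqrt_pos.2 hw
  unfold angleDefect
  positivity

theorem angleDefect_le {p a u w : ℝ} (hp : 1 < p) (ha : 0 < a) (hu : u ∈ Ioo (0 : ℝ) 1)
    (hw : 0 < w) (h : 4 ≤ (w + 4) * u) :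
    angleDefect p a u w ≤ p * (p + 1) / ((p - 1) * a) * (√(u * (1 - u)))⁻¹ := by
  have hp1 : 0 < p - 1 := by linarith
  have hu0 := hu.1
  have hx : p / (a * (u * ((p - 1) * w + 2 * p))) ≤ p * (p + 1) / ((p - 1) * a) := by
    have h1 : p - 1 ≤ (p + 1) * (u * ((p - 1) * w + 2 * p)) := by
      have h2 : (p - 1) * 4 ≤ (p - 1) * ((w + 4) * u) := by gcongr
      have h3 : 0 ≤ p * (u * ((p - 1) * w)) := by positivity
      have h4 : 0 ≤ u * (p ^ 2 + (p - 1) ^ 2 + 3) := by positivity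
      nlinarith
    rw [div_le_div_iff₀ (by positivity) (by positivity)]
    calc p * ((p - 1) * a) ≤ p * ((p + 1) * (u * ((p - 1) * w + 2 * p)) * a) := by gcongr
      _ = _ := by ring
  unfold angleDefect
  exact mul_le_mul hx (inv_mul_sqrt_le hu h) (by positivity) (by positivity)

theorem Fa_mul_deriv_anglePrimitive {p a u w : ℝ} (hp : 1 < p) (ha : 0 < a) (hu : 0 < u)
    (hw : 0 < w) :
    Fa p a u w * ((4 + (p - 1) * w) / (2 * √w * (w + 4) * ((p - 1) * w + 2 * p))) =
      (u * √w)⁻¹ + angleDefect p a u w := by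
  have hcw : 0 < (p - 1) * w := mul_pos (by linarith) hw
  have := sqrt_pos.2 hw
  rw [Fa_eq hp ha hu hw.le, angleDefect]
  generalize (p - 1) * w = v at *
  have h1 : 0 < 4 + (p - 1) * w := by positivity
  have h2 : 0 < (p - 1) * w + 2 * p := by positivity
  field_simp
  ring

namespace IsGFamily

variable {p : ℝ} {G : ℝ → ℝ → ℝ} {a : ℝ}

theorem intervalIntegrable_angleDefect (hp : 1 < p) (hG : IsGFamily p G) (ha : 0 < a) :
    IntervalIntegrable (fun u => angleDefect p a u (G a u)) volume 0 1 := by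
  have hb := intervalIntegrable_inv_sqrt_mul_one_sub.const_mul (p * (p + 1) / ((p - 1) * a))
  refine hb.mono_fun ?_ ?_
  · rw [uIoc_of_le zero_le_one, ← Measure.restrict_congr_set Ioo_ae_eq_Ioc]
    refine ContinuousOn.aestronglyMeasurable ?_ measurableSet_Ioo
    have hc := hG.continuousOn_Ioo ha
    unfold angleDefect
    refine ContinuousOn.mul (continuousOn_const.div ?_ fun u hu => ?_)
      ((continuousOn_id.mul hc.sqrt).inv₀ fun u hu => ?_)
    · fun_prop
    · have h0 := hu.1
      have : 0 < (p - 1) * G a u := mul_pos (by linarith) ((hG a ha).2.2.2.1 u hu)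
      positivity
    · exact mul_ne_zero hu.1.ne' (sqrt_pos.2 ((hG a ha).2.2.2.1 u hu)).ne'
  · rw [Filter.EventuallyLE, ae_restrict_iff' measurableSet_uIoc]
    filter_upwards [Measure.ae_ne volume (1 : ℝ)] with u hu1 hu
    rw [uIoc_of_le zero_le_one] at hu
    have hu' : u ∈ Ioo (0 : ℝ) 1 := ⟨hu.1, hu.2.lt_of_ne hu1⟩
    have hpos := (hG a ha).2.2.2.1 u hu'
    rw [norm_of_nonneg (angleDefect_pos hp ha hu.1 hpos).le]
    exact (angleDefect_le hp ha hu' hpos (hG.four_le hp ha hu)).trans (le_abs_self _)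

theorem thetaA_add_integral_angleDefect (hp : 1 < p) (hG : IsGFamily p G) (ha : 0 < a) :
    thetaA G a + ∫ u in (0 : ℝ)..1, angleDefect p a u (G a u) = limitAngle p := by
  have h1 := hG.intervalIntegrable hp ha
  have h2 := hG.intervalIntegrable_angleDefect hp ha
  rw [thetaA_eq G ha, ← intervalIntegral.integral_add h1 h2]
  have hder : ∀ u ∈ Ioo (0 : ℝ) 1, HasDerivAt (fun u => -anglePrimitive p (G a u))
      ((u * √(G a u))⁻¹ + angleDefect p a u (G a u)) u := by
    intro u hu
    have hpos := (hG a ha).2.2.2.1 u hu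
    have h := ((hasDerivAt_anglePrimitive hp hpos).comp u ((hG a ha).2.2.1 u hu)).neg
    refine h.congr_deriv ?_
    rw [← Fa_mul_deriv_anglePrimitive hp ha hu.1 hpos]
    ring
  have hlim0 : Tendsto (fun u => -anglePrimitive p (G a u)) (nhdsWithin 0 (Ioi 0))
      (nhds (-limitAngle p)) :=
    ((tendsto_anglePrimitive_atTop hp).comp (hG.tendsto_zero hp ha)).neg
  have hlim1 : Tendsto (fun u => -anglePrimitive p (G a u)) (nhdsWithin 1 (Iio 1)) (nhds 0) := by
    have := (((continuous_anglePrimitive p).tendsto 0).comp (hG.tendsto_one ha)).neg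
    simpa [anglePrimitive_zero] using this
  rw [intervalIntegral.integral_eq_sub_of_hasDerivAt_of_tendsto zero_lt_one hder (h1.add h2)
    hlim0 hlim1]
  ring

theorem thetaA_lt (hp : 1 < p) (hG : IsGFamily p G) (ha : 0 < a) :
    thetaA G a < limitAngle p := by
  rw [← hG.thetaA_add_integral_angleDefect hp ha]
  refine lt_add_of_pos_right _ <| intervalIntegral.intervalIntegral_pos_of_pos_on
    (hG.intervalIntegrable_angleDefect hp ha) (fun u hu => ?_) zero_lt_one
  exact angleDefect_pos hp ha hu.1 ((hG a ha).2.2.2.1 u hu)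

theorem tendsto_thetaA_atTop_limitAngle (hp : 1 < p) (hG : IsGFamily p G) :
    Tendsto (thetaA G) atTop (nhds (limitAngle p)) := by
  set I := ∫ u in (0 : ℝ)..1, (√(u * (1 - u)))⁻¹
  have hlow : Tendsto (fun a : ℝ => limitAngle p - p * (p + 1) / (p - 1) * I * a⁻¹) atTop
      (nhds (limitAngle p)) := by
    simpa using (tendsto_inv_atTop_zero.const_mul (p * (p + 1) / (p - 1) * I)).const_sub
      (limitAngle p)
  refine tendsto_of_tendsto_of_tendsto_of_le_of_le' hlow tendsto_const_nhds ?_ ?_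
  · filter_upwards [eventually_gt_atTop 0] with a ha
    rw [← hG.thetaA_add_integral_angleDefect hp ha, add_sub_assoc]
    refine add_le_of_nonpos_right (sub_nonpos.2 ?_)
    have h := intervalIntegral.integral_mono_on_of_le_Ioo zero_le_one
      (hG.intervalIntegrable_angleDefect hp ha)
      (intervalIntegrable_inv_sqrt_mul_one_sub.const_mul (p * (p + 1) / ((p - 1) * a)))
      fun u hu => angleDefect_le hp ha hu ((hG a ha).2.2.2.1 u hu)
        (hG.four_le hp ha ⟨hu.1, hu.2.le⟩)
    rw [intervalIntegral.integral_const_mul] at h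
    refine h.trans_eq ?_
    rw [← div_div]
    ring
  · filter_upwards [eventually_gt_atTop 0] with a ha using (hG.thetaA_lt hp ha).le

end IsGFamily

theorem thetaA_limits_and_range (p : ℝ) (hp : 1 < p)
    (G : ℝ → ℝ → ℝ) (K : ℝ → ℝ) (hG : IsGFamily p G)
    (hK : ∀ y ∈ Set.Ioc (0:ℝ) 1,
      Filter.Tendsto (fun a => G a y) Filter.atTop (nhds (K y)))
    (hfin : ∀ a : ℝ, 0 < a →
      MeasureTheory.IntegrableOn (fun w => (Real.sqrt (Ha G a w))⁻¹) (Set.Ioo 0 a)) :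
    Filter.Tendsto (thetaA G) (nhdsWithin 0 (Set.Ioi 0)) (nhds 0) ∧
    Filter.Tendsto (thetaA G) Filter.atTop
      (nhds (∫ u in Set.Ioo (0:ℝ) 1, (u * Real.sqrt (K u))⁻¹)) ∧
    (∫ u in Set.Ioo (0:ℝ) 1, (u * Real.sqrt (K u))⁻¹)
      = (Real.pi/2) * (1 - (1/2) * Real.sqrt (2*(p-1)/p)) ∧
    (thetaA G) '' (Set.Ioi 0)
      = Set.Ioo 0 ((Real.pi/2) * (1 - (1/2) * Real.sqrt (2*(p-1)/p))) := by
  have hI : ∫ u in Ioo (0 : ℝ) 1, (u * √(K u))⁻¹ = ∫ u in (0 : ℝ)..1, (u * √(K u))⁻¹ := by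
    rw [intervalIntegral.integral_of_le zero_le_one, integral_Ioc_eq_integral_Ioo]
  have h0 := hG.tendsto_thetaA_zero hp
  have hL := hG.tendsto_thetaA_atTop_limitAngle hp
  have hT := hG.tendsto_thetaA_atTop hp hK
  rw [hI]
  refine ⟨h0, hT, tendsto_nhds_unique hT hL, ?_⟩
  change _ = Ioo 0 (limitAngle p)
  refine Subset.antisymm ?_ ?_
  · rintro _ ⟨a, ha, rfl⟩
    exact ⟨hG.thetaA_pos hp ha, hG.thetaA_lt hp ha⟩
  · rintro t ⟨ht0, htL⟩
    obtain ⟨a, hat, ha⟩ := ((h0.eventually (gt_mem_nhds ht0)).and self_mem_nhdsWithin).exists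
    obtain ⟨b, hbt, hb⟩ := ((hL.eventually (lt_mem_nhds htL)).and (eventually_gt_atTop 0)).exists
    exact isPreconnected_Ioi.intermediate_value ha hb (hG.continuousOn_thetaA hp)
      ⟨hat.le, hbt.le⟩
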